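/- arXiv:1802.08556 — 3 statements merged into one kernel-verified Lean document; each statement's English description precedes it below -/
import Mathlib

section
/- Let h: ℝ^d → ℝ ∪ {+∞} be a proper function, let z_1,…,z_I ∈ ℝ^d and a_1,…,a_I > 0, and define f(y) = h(y) + Σ_{i=1}^I (a_i/2)‖y − z_i‖². Fix λ > 0, set A = Σ_{i=1}^I a_i, and for a given x ∈ ℝ^d let x̄ = (λx + Σ_{i=1}^I a_i z_i)/(λ + A) and Q(y) = (λ/2)‖y − x‖² + Σ_{i=1}^I (a_i/2)‖y − z_i‖². Then the Moreau envelopes satisfy f_{1/λ}(x) = h_{1/(λ+A)}(x̄) + Q(x̄). -/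
open scoped BigOperators

/-- Adding a real constant commutes with infima in `EReal`. -/
theorem EReal.iInf_add_coe {ι : Sort*} (g : ι → EReal) (c : ℝ) :
    (⨅ i, g i + (c : EReal)) = (⨅ i, g i) + (c : EReal) := by
  apply le_antisymm
  · rw [← EReal.sub_le_iff_le_add (Or.inl (EReal.coe_ne_bot c)) (Or.inl (EReal.coe_ne_top c))]
    refine le_iInf fun i => ?_
    rw [EReal.sub_le_iff_le_add (Or.inl (EReal.coe_ne_bot c)) (Or.inl (EReal.coe_ne_top c))]
    exact iInf_le _ i
  · exact le_iInf fun i => add_le_add_left (iInf_le g i) _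

/-- A weighted sum of half squared distances, expanded around an arbitrary point `m`. -/
theorem sum_half_mul_norm_sub_sq {ι E : Type*} [NormedAddCommGroup E] [InnerProductSpace ℝ E]
    (s : Finset ι) (a : ι → ℝ) (z : ι → E) (m y : E) :
    ∑ i ∈ s, a i / 2 * ‖y - z i‖ ^ 2 =
      (∑ i ∈ s, a i) / 2 * ‖y - m‖ ^ 2 +
        inner ℝ (y - m) ((∑ i ∈ s, a i) • m - ∑ i ∈ s, a i • z i) +
        ∑ i ∈ s, a i / 2 * ‖m - z i‖ ^ 2 := by
  rw [Finset.sum_smul, ← Finset.sum_sub_distrib, inner_sum, Finset.sum_div, Finset.sum_mul,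
    ← Finset.sum_add_distrib, ← Finset.sum_add_distrib]
  refine Finset.sum_congr rfl fun i _ => ?_
  rw [← smul_sub, inner_smul_right, ← sub_add_sub_cancel y m (z i), norm_add_sq_real]
  ring

/-- **Moreau envelope of a quadratic perturbation (value form).**
Let `h : ℝ^d → ℝ ∪ {+∞}` be proper, `z 1, …, z I ∈ ℝ^d`, `a i > 0`, and define
`f y = h y + ∑ i, (a i / 2) ‖y - z i‖²`.  For `lam > 0`, with `A = ∑ i, a i`,
`x̄ = (lam • x + ∑ i, a i • z i)/(lam + A)`, and
`Q y = (lam/2)‖y - x‖² + ∑ i, (a i/2)‖y - z i‖²`, the Moreau envelopes satisfy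
`f_{1/lam}(x) = h_{1/(lam+A)}(x̄) + Q(x̄)`, where
`φ_{1/ν}(w) = inf_y { φ(y) + (ν/2)‖y - w‖² }`. -/
theorem moreau_envelope_of_regularization_value {d I : ℕ}
    (h : EuclideanSpace ℝ (Fin d) → EReal)
    (hne_bot : ∀ x, h x ≠ ⊥) (hproper : ∃ x, h x ≠ ⊤)
    (z : Fin I → EuclideanSpace ℝ (Fin d)) (a : Fin I → ℝ) (ha : ∀ i, 0 < a i)
    (f : EuclideanSpace ℝ (Fin d) → EReal)
    (hf : ∀ y, f y = h y + ((∑ i, a i / 2 * ‖y - z i‖ ^ 2 : ℝ) : EReal))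
    (lam : ℝ) (hlam : 0 < lam)
    (A : ℝ) (hA : A = ∑ i, a i)
    (x : EuclideanSpace ℝ (Fin d))
    (xbar : EuclideanSpace ℝ (Fin d))
    (hxbar : xbar = (lam + A)⁻¹ • (lam • x + ∑ i, a i • z i))
    (Q : EuclideanSpace ℝ (Fin d) → ℝ)
    (hQ : ∀ y, Q y = lam / 2 * ‖y - x‖ ^ 2 + ∑ i, a i / 2 * ‖y - z i‖ ^ 2) :
    (⨅ y, f y + ((lam / 2 * ‖y - x‖ ^ 2 : ℝ) : EReal)) =
      (⨅ y, h y + (((lam + A) / 2 * ‖y - xbar‖ ^ 2 : ℝ) : EReal)) + ((Q xbar : ℝ) : EReal) := by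
  have hA0 : 0 ≤ A := hA ▸ Finset.sum_nonneg fun i _ => (ha i).le
  have hpos : lam + A ≠ 0 := by positivity
  have hcentroid : lam • xbar + A • xbar = lam • x + ∑ i, a i • z i := by
    rw [← add_smul, hxbar, smul_inv_smul₀ hpos]
  have hQ_expand (y : EuclideanSpace ℝ (Fin d)) :
      Q y = (lam + A) / 2 * ‖y - xbar‖ ^ 2 + Q xbar := by
    have hcross : inner ℝ (y - xbar) (A • xbar - ∑ i, a i • z i) =
        lam * inner ℝ (y - xbar) (x - xbar) := by
      rw [← inner_smul_right, smul_sub]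
      congr 1
      rw [sub_eq_sub_iff_add_eq_add, add_comm, hcentroid]
    rw [hQ, hQ, sum_half_mul_norm_sub_sq _ _ _ xbar, ← hA, hcross,
      ← sub_add_sub_cancel y xbar x, norm_add_sq_real, ← neg_sub x xbar, inner_neg_right]
    ring
  rw [← EReal.iInf_add_coe]
  refine iInf_congr fun y => ?_
  rw [hf, add_assoc, add_assoc, ← EReal.coe_add, ← EReal.coe_add, ← hQ_expand, hQ, add_comm (lam / 2 * _)]
end

section
/- Let h: ℝ^d → ℝ ∪ {+∞} be a proper closed convex function, let z_1,…,z_I ∈ ℝ^d and a_1,…,a_I > 0, and define f(y) = h(y) + Σ_{i=1}^I (a_i/2)‖y − z_i‖². Fix λ > 0 and set A = Σ_{i=1}^I a_i. Then for every x ∈ ℝ^d, with x̄ = (λx + Σ_{i=1}^I a_i z_i)/(λ + A), the Moreau envelopes f_{1/λ} and h_{1/(λ+A)} are differentiable and satisfy ∇f_{1/λ}(x) = (λ/(λ+A)) (∇h_{1/(λ+A)}(x̄) + Σ_{i=1}^I a_i (x − z_i)). -/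
open scoped BigOperators

/-- Convexity for an extended-real-valued function on `ℝ^d`. -/
def ERealConvexOn {d : ℕ} (φ : EuclideanSpace ℝ (Fin d) → EReal) : Prop :=
  ∀ x y : EuclideanSpace ℝ (Fin d), ∀ t : ℝ, 0 ≤ t → t ≤ 1 →
    φ (t • x + (1 - t) • y) ≤ (t : EReal) * φ x + ((1 - t : ℝ) : EReal) * φ y

namespace ERealConvexOn

variable {d : ℕ} {h : EuclideanSpace ℝ (Fin d) → EReal}

/-- The convexity inequality at two points where the function is finite. -/
theorem le_coe (hconv : ERealConvexOn h) {x y : EuclideanSpace ℝ (Fin d)} {r s t : ℝ}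
    (hx : h x = r) (hy : h y = s) (ht0 : 0 ≤ t) (ht1 : t ≤ 1) :
    h (t • x + (1 - t) • y) ≤ ((t * r + (1 - t) * s : ℝ) : EReal) := by
  have := hconv x y t ht0 ht1
  rw [hx, hy] at this
  exact_mod_cast this

/-- A proper lower semicontinuous convex function decays at most linearly. -/
theorem exists_linear_lower_bound (hconv : ERealConvexOn h) (hne_bot : ∀ x, h x ≠ ⊥)
    (hlsc : LowerSemicontinuous h) {x₀ : EuclideanSpace ℝ (Fin d)} {h₀ : ℝ} (hx₀ : h x₀ = h₀) :
    ∃ c K : ℝ, 0 ≤ K ∧ ∀ y, ((c - K * ‖y - x₀‖ : ℝ) : EReal) ≤ h y := by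
  obtain ⟨p, -, hpmin⟩ := (hlsc.lowerSemicontinuousOn _).exists_isMinOn
    (Metric.nonempty_closedBall.2 zero_le_one) (isCompact_closedBall x₀ (1 : ℝ))
  have hp₀ : h p ≤ h₀ := hx₀ ▸ hpmin (Metric.mem_closedBall_self zero_le_one)
  lift h p to ℝ using ⟨ne_top_of_le_ne_top (EReal.coe_ne_top _) hp₀, hne_bot p⟩ with m hm
  have hm₀ : m ≤ h₀ := by exact_mod_cast hp₀
  refine ⟨m, h₀ - m, sub_nonneg.2 hm₀, fun y => ?_⟩
  rcases le_or_gt ‖y - x₀‖ 1 with hr | hr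
  · refine le_trans ?_ (hm ▸ hpmin (by simpa [dist_eq_norm] using hr) : (m : EReal) ≤ h y)
    exact_mod_cast sub_le_self m (mul_nonneg (sub_nonneg.2 hm₀) (norm_nonneg _))
  · by_cases hy : h y = ⊤
    · simp [hy]
    lift h y to ℝ using ⟨hy, hne_bot y⟩ with s hs
    have hr0 : 0 < ‖y - x₀‖ := one_pos.trans hr
    have hmem : ‖y - x₀‖⁻¹ • y + (1 - ‖y - x₀‖⁻¹) • x₀ ∈ Metric.closedBall x₀ (1 : ℝ) := by
      have : ‖y - x₀‖⁻¹ • y + (1 - ‖y - x₀‖⁻¹) • x₀ - x₀ = ‖y - x₀‖⁻¹ • (y - x₀) := by module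
      rw [mem_closedBall_iff_norm, this, norm_smul, norm_inv, norm_norm,
        inv_mul_cancel₀ hr0.ne']
    have hle : m ≤ ‖y - x₀‖⁻¹ * s + (1 - ‖y - x₀‖⁻¹) * h₀ := by
      have := (hm ▸ hpmin hmem : (m : EReal) ≤ _).trans
        (hconv.le_coe hs.symm hx₀ (inv_nonneg.2 hr0.le) (inv_le_one_of_one_le₀ hr.le))
      exact_mod_cast this
    have hmul := mul_le_mul_of_nonneg_left hle hr0.le
    have : ‖y - x₀‖ * (‖y - x₀‖⁻¹ * s + (1 - ‖y - x₀‖⁻¹) * h₀)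
        = s + (‖y - x₀‖ - 1) * h₀ := by field_simp
    have : m - (h₀ - m) * ‖y - x₀‖ ≤ s := by nlinarith
    exact_mod_cast this

/-- The infimum defining the Moreau envelope of a proper lower semicontinuous convex function
is attained, at a point where the function is finite. -/
theorem exists_prox (hconv : ERealConvexOn h) (hne_bot : ∀ x, h x ≠ ⊥)
    (hproper : ∃ x, h x ≠ ⊤) (hlsc : LowerSemicontinuous h) {μ : ℝ} (hμ : 0 < μ)
    (w : EuclideanSpace ℝ (Fin d)) :
    ∃ (p : EuclideanSpace ℝ (Fin d)) (r : ℝ), h p = r ∧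
      ∀ y, ((r + μ / 2 * ‖p - w‖ ^ 2 : ℝ) : EReal) ≤ h y + ((μ / 2 * ‖y - w‖ ^ 2 : ℝ) : EReal) := by
  obtain ⟨x₀, hx₀⟩ := hproper
  obtain ⟨h₀, hh₀⟩ : ∃ h₀ : ℝ, h x₀ = h₀ := ⟨_, (EReal.coe_toReal hx₀ (hne_bot x₀)).symm⟩
  obtain ⟨c, K, hK, hbound⟩ := hconv.exists_linear_lower_bound hne_bot hlsc hh₀
  set φ : EuclideanSpace ℝ (Fin d) → EReal :=
    fun y => h y + ((μ / 2 * ‖y - w‖ ^ 2 : ℝ) : EReal) with hφ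
  have hφlsc : LowerSemicontinuous φ := by
    refine hlsc.add' (Continuous.lowerSemicontinuous ?_) fun y => ?_
    · exact continuous_coe_real_ereal.comp (by fun_prop)
    · exact EReal.continuousAt_add (Or.inr (EReal.coe_ne_bot _)) (Or.inr (EReal.coe_ne_top _))
  set s := ‖x₀ - w‖ with hs
  set R := 1 + 2 / μ * (K + μ * s + |h₀ - c|) with hR
  have hs0 : 0 ≤ s := norm_nonneg _
  have hR1 : 1 ≤ R := by
    have : 0 ≤ 2 / μ * (K + μ * s + |h₀ - c|) := by positivity
    linarith
  have hx₀mem : x₀ ∈ Metric.closedBall x₀ R := Metric.mem_closedBall_self (by linarith)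
  obtain ⟨p, -, hpmin⟩ := (hφlsc.lowerSemicontinuousOn _).exists_isMinOn
    ⟨x₀, hx₀mem⟩ (isCompact_closedBall x₀ R)
  have hφ₀ : φ x₀ = ((h₀ + μ / 2 * s ^ 2 : ℝ) : EReal) := by
    simp only [hφ, hh₀, hs, EReal.coe_add]
  have hp₀ : φ p ≤ ((h₀ + μ / 2 * s ^ 2 : ℝ) : EReal) := hφ₀ ▸ hpmin hx₀mem
  have hptop : h p ≠ ⊤ := by
    intro htop
    simp only [hφ, htop, EReal.top_add_coe, top_le_iff] at hp₀
    exact EReal.coe_ne_top _ hp₀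
  have hpr := EReal.coe_toReal hptop (hne_bot p)
  refine ⟨p, (h p).toReal, hpr.symm, fun y => ?_⟩
  rw [EReal.coe_add, hpr]
  change φ p ≤ φ y
  rcases le_or_gt ‖y - x₀‖ R with hr | hr
  · exact hpmin (mem_closedBall_iff_norm.2 hr)
  refine hp₀.trans (le_trans ?_ (add_le_add_left (hbound y) _))
  norm_cast
  have htri : ‖y - x₀‖ - s ≤ ‖y - w‖ := by
    have := norm_sub_le_norm_sub_add_norm_sub y w x₀
    rw [norm_sub_rev w x₀] at this
    linarith
  have hRμ : μ / 2 * R = μ / 2 + (K + μ * s + |h₀ - c|) := by rw [hR]; field_simp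
  have hsR : s ≤ R := by
    by_contra! hlt
    nlinarith [abs_nonneg (h₀ - c)]
  have hsq : (‖y - x₀‖ - s) ^ 2 ≤ ‖y - w‖ ^ 2 :=
    pow_le_pow_left₀ (by linarith) htri 2
  have h1 : |h₀ - c| ≤ μ / 2 * ‖y - x₀‖ - (K + μ * s) := by nlinarith
  have h2 : |h₀ - c| ≤ ‖y - x₀‖ * (μ / 2 * ‖y - x₀‖ - (K + μ * s)) :=
    h1.trans (le_mul_of_one_le_left ((abs_nonneg _).trans h1) (by linarith))
  nlinarith [le_abs_self (h₀ - c), mul_le_mul_of_nonneg_left hsq (half_pos hμ).le]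

/-- The Moreau envelope of a proper lower semicontinuous convex function is real valued,
attained and differentiable. -/
theorem exists_moreauEnvelope (hconv : ERealConvexOn h) (hne_bot : ∀ x, h x ≠ ⊥)
    (hproper : ∃ x, h x ≠ ⊤) (hlsc : LowerSemicontinuous h) {μ : ℝ} (hμ : 0 < μ) :
    ∃ (m : EuclideanSpace ℝ (Fin d) → ℝ) (g : EuclideanSpace ℝ (Fin d) → EuclideanSpace ℝ (Fin d)),
      (∀ w, (m w : EReal) = ⨅ y, h y + ((μ / 2 * ‖y - w‖ ^ 2 : ℝ) : EReal)) ∧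
      (∀ w, ∃ p, (m w : EReal) = h p + ((μ / 2 * ‖p - w‖ ^ 2 : ℝ) : EReal)) ∧
      ∀ w, HasGradientAt m (g w) w := by
  choose p r hpr hmin using hconv.exists_prox hne_bot hproper hlsc hμ
  set m : EuclideanSpace ℝ (Fin d) → ℝ := fun w => r w + μ / 2 * ‖p w - w‖ ^ 2 with hm
  have hmp (w) : (m w : EReal) = h (p w) + ((μ / 2 * ‖p w - w‖ ^ 2 : ℝ) : EReal) := by
    rw [hpr, hm, EReal.coe_add]
  refine ⟨m, fun w => μ • (w - p w), fun w => le_antisymm (le_iInf (hmin w)) ?_,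
    fun w => ⟨p w, hmp w⟩, fun w => ?_⟩
  · exact hmp w ▸ iInf_le _ (p w)
  have hupper (v w) : m v ≤ m w + inner ℝ (μ • (w - p w)) (v - w) + μ / 2 * ‖v - w‖ ^ 2 := by
    have h1 := hmin v (p w)
    rw [hpr, ← EReal.coe_add, EReal.coe_le_coe_iff] at h1
    have h2 : p w - v = (p w - w) - (v - w) := by abel
    have h3 : ‖p w - v‖ ^ 2 = ‖p w - w‖ ^ 2 + 2 * inner ℝ (w - p w) (v - w) + ‖v - w‖ ^ 2 := by
      rw [h2, norm_sub_sq_real, ← neg_sub w (p w), inner_neg_left]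
      ring
    rw [h3] at h1
    rw [real_inner_smul_left]
    simp only [hm]
    linarith
  have hmid (u v) : m ((1 / 2 : ℝ) • u + (1 - 1 / 2 : ℝ) • v) ≤ (m u + m v) / 2 := by
    have h1 := (hmin ((1 / 2 : ℝ) • u + (1 - 1 / 2 : ℝ) • v)
      ((1 / 2 : ℝ) • p u + (1 - 1 / 2 : ℝ) • p v)).trans (add_le_add_left
        (hconv.le_coe (hpr u) (hpr v) (t := 1 / 2) (by norm_num) (by norm_num)) _)
    rw [← EReal.coe_add, EReal.coe_le_coe_iff] at h1
    have h2 : (1 / 2 : ℝ) • p u + (1 - 1 / 2 : ℝ) • p v - ((1 / 2 : ℝ) • u + (1 - 1 / 2 : ℝ) • v)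
        = (1 / 2 : ℝ) • ((p u - u) + (p v - v)) := by module
    have h3 : ‖(1 / 2 : ℝ) • ((p u - u) + (p v - v))‖ ^ 2
        ≤ (‖p u - u‖ ^ 2 + ‖p v - v‖ ^ 2) / 2 := by
      rw [norm_smul, mul_pow]
      norm_num
      nlinarith [parallelogram_law_with_norm ℝ (p u - u) (p v - v),
        mul_self_nonneg ‖(p u - u) - (p v - v)‖]
    rw [h2] at h1
    have h4 := mul_le_mul_of_nonneg_left h3 (half_pos hμ).le
    simp only [hm] at h1 ⊢
    linarith
  rw [hasGradientAt_iff_isLittleO]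
  have hO : (fun v => m v - m w - inner ℝ (μ • (w - p w)) (v - w))
      =O[nhds w] fun v => ‖v - w‖ ^ 2 := by
    refine Asymptotics.IsBigO.of_bound (μ / 2) (Filter.Eventually.of_forall fun v => ?_)
    rw [Real.norm_eq_abs, norm_pow, norm_norm, abs_le]
    have h1 := hupper v w
    have h2 := hupper ((2 : ℝ) • w - v) w
    have h3 := hmid v ((2 : ℝ) • w - v)
    rw [show (1 / 2 : ℝ) • v + (1 - 1 / 2 : ℝ) • ((2 : ℝ) • w - v) = w by module] at h3
    rw [show (2 : ℝ) • w - v - w = -(v - w) by module, inner_neg_right, norm_neg] at h2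
    constructor <;> linarith
  refine hO.trans_isLittleO ?_
  have : Filter.Tendsto (fun v => v - w) (nhds w) (nhds 0) :=
    tendsto_sub_nhds_zero_iff.2 Filter.tendsto_id
  exact (Asymptotics.isLittleO_norm_pow_id one_lt_two).comp_tendsto this

end ERealConvexOn

/-- Completing the square for a weighted sum of squared distances. -/
theorem sum_sq_norm_sub_add_sq_norm_sub {E : Type*} [NormedAddCommGroup E]
    [InnerProductSpace ℝ E] {ι : Type*} [Fintype ι] (z : ι → E) (a : ι → ℝ) {lam : ℝ}
    (hμ : lam + ∑ i, a i ≠ 0) (x y : E) :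
    (∑ i, a i / 2 * ‖y - z i‖ ^ 2) + lam / 2 * ‖y - x‖ ^ 2 =
      (lam + ∑ i, a i) / 2 * ‖y - (lam + ∑ i, a i)⁻¹ • (lam • x + ∑ i, a i • z i)‖ ^ 2 +
        (lam / 2 * ‖x‖ ^ 2 + (∑ i, a i / 2 * ‖z i‖ ^ 2) - (lam + ∑ i, a i) / 2 *
          ‖(lam + ∑ i, a i)⁻¹ • (lam • x + ∑ i, a i • z i)‖ ^ 2) := by
  have h1 : ∑ i, a i / 2 * ‖y - z i‖ ^ 2 =
      (∑ i, a i) / 2 * ‖y‖ ^ 2 - inner ℝ y (∑ i, a i • z i) + ∑ i, a i / 2 * ‖z i‖ ^ 2 := by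
    rw [inner_sum, Finset.sum_div, Finset.sum_mul, ← Finset.sum_sub_distrib,
      ← Finset.sum_add_distrib]
    refine Finset.sum_congr rfl fun i _ => ?_
    rw [norm_sub_sq_real, real_inner_smul_right]
    ring
  rw [h1, norm_sub_sq_real y x, norm_sub_sq_real y, real_inner_smul_right, inner_add_right,
    real_inner_smul_right]
  field_simp
  ring

/-- **Moreau envelope of a quadratic perturbation (gradient form).**
Let `h : ℝ^d → ℝ ∪ {+∞}` be proper, closed (lower semicontinuous) and convex,
`z 1, …, z I ∈ ℝ^d`, `a i > 0`, and `f y = h y + ∑ i, (a i/2)‖y - z i‖²`.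
Fix `lam > 0` and set `A = ∑ i, a i`.  Then the Moreau envelopes `f_{1/lam}` and
`h_{1/(lam+A)}` (real valued functions `mf`, `mh`) are differentiable everywhere, and
for every `x`, with `x̄ = (lam • x + ∑ i, a i • z i)/(lam + A)`,
`∇f_{1/lam}(x) = (lam/(lam+A)) • (∇h_{1/(lam+A)}(x̄) + ∑ i, a i • (x - z i))`. -/
theorem moreau_envelope_of_regularization_gradient {d I : ℕ}
    (h : EuclideanSpace ℝ (Fin d) → EReal)
    (hne_bot : ∀ x, h x ≠ ⊥) (hproper : ∃ x, h x ≠ ⊤)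
    (hlsc : LowerSemicontinuous h) (hconv : ERealConvexOn h)
    (z : Fin I → EuclideanSpace ℝ (Fin d)) (a : Fin I → ℝ) (ha : ∀ i, 0 < a i)
    (f : EuclideanSpace ℝ (Fin d) → EReal)
    (hf : ∀ y, f y = h y + ((∑ i, a i / 2 * ‖y - z i‖ ^ 2 : ℝ) : EReal))
    (lam : ℝ) (hlam : 0 < lam)
    (A : ℝ) (hA : A = ∑ i, a i) :
    ∃ mf mh : EuclideanSpace ℝ (Fin d) → ℝ,
      (∀ w, ((mf w : ℝ) : EReal) = ⨅ y, f y + ((lam / 2 * ‖y - w‖ ^ 2 : ℝ) : EReal)) ∧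
      (∀ w, ((mh w : ℝ) : EReal) = ⨅ y, h y + (((lam + A) / 2 * ‖y - w‖ ^ 2 : ℝ) : EReal)) ∧
      ∃ gf gh : EuclideanSpace ℝ (Fin d) → EuclideanSpace ℝ (Fin d),
        (∀ w, HasGradientAt mf (gf w) w) ∧
        (∀ w, HasGradientAt mh (gh w) w) ∧
        ∀ x, gf x = (lam / (lam + A)) •
            (gh ((lam + A)⁻¹ • (lam • x + ∑ i, a i • z i)) + ∑ i, a i • (x - z i)) := by
  have hμ : 0 < lam + A := by
    have : 0 ≤ A := hA ▸ Finset.sum_nonneg fun i _ => (ha i).le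
    linarith
  obtain ⟨mh, gh, hmh, hatt, hgh⟩ := hconv.exists_moreauEnvelope hne_bot hproper hlsc hμ
  set b : EuclideanSpace ℝ (Fin d) → EuclideanSpace ℝ (Fin d) :=
    fun x => (lam + A)⁻¹ • (lam • x + ∑ i, a i • z i) with hb
  set q : EuclideanSpace ℝ (Fin d) → ℝ := fun x =>
    lam / 2 * ‖x‖ ^ 2 + (∑ i, a i / 2 * ‖z i‖ ^ 2) - (lam + A) / 2 * ‖b x‖ ^ 2 with hq
  have hfq (x y) : f y + ((lam / 2 * ‖y - x‖ ^ 2 : ℝ) : EReal) =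
      h y + (((lam + A) / 2 * ‖y - b x‖ ^ 2 : ℝ) : EReal) + ((q x : ℝ) : EReal) := by
    have hsq := sum_sq_norm_sub_add_sq_norm_sub z a (hA ▸ hμ.ne') x y
    rw [← hA] at hsq
    rw [hf, add_assoc, add_assoc, ← EReal.coe_add, ← EReal.coe_add, hsq]
  refine ⟨fun x => mh (b x) + q x, mh, fun x => ?_, hmh,
    fun x => (lam / (lam + A)) • (gh (b x) + ∑ i, a i • (x - z i)), gh, fun x => ?_, hgh,
    fun x => rfl⟩
  · simp only [hfq, EReal.coe_add]
    refine le_antisymm (le_iInf fun y => add_le_add_left (hmh (b x) ▸ iInf_le _ y) _) ?_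
    obtain ⟨p, hp⟩ := hatt (b x)
    rw [hp]
    exact iInf_le (fun y => h y + (((lam + A) / 2 * ‖y - b x‖ ^ 2 : ℝ) : EReal) +
      ((q x : ℝ) : EReal)) p
  · have hbd : HasFDerivAt b
        ((lam + A)⁻¹ • lam • ContinuousLinearMap.id ℝ (EuclideanSpace ℝ (Fin d))) x :=
      (((hasFDerivAt_id x).const_smul lam).add_const (∑ i, a i • z i)).const_smul (lam + A)⁻¹
    have hsum : ∑ i, a i • (x - z i) = (lam + A) • (x - b x) := by
      simp only [hb, smul_sub, Finset.sum_sub_distrib, ← Finset.sum_smul, ← hA,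
        smul_inv_smul₀ hμ.ne']
      module
    have hmd := (hgh (b x)).hasFDerivAt.comp x hbd
    have hqd := ((((hasFDerivAt_id x).norm_sq).const_mul (lam / 2)).add_const
      (∑ i, a i / 2 * ‖z i‖ ^ 2)).sub ((hbd.norm_sq).const_mul ((lam + A) / 2))
    beta_reduce
    rw [hsum, hasGradientAt_iff_hasFDerivAt]
    refine (hmd.add hqd).congr_fderiv ?_
    ext v
    simp
    field_simp
end

section
/- Let φ: ℝ^d → ℝ ∪ {+∞} be a proper, lower semicontinuous, convex function, let x_c ∈ ℝ^d, μ > 0, λ > 0, D > 0, and define the quadratic perturbation φ̂(x) = φ(x) + (μ/2)‖x − x_c‖². Then for any x̄ ∈ ℝ^d with ‖x̄ − x_c‖ ≤ D, setting z̄ = (μ/(μ+λ)) x_c + (λ/(μ+λ)) x̄, the Moreau envelopes satisfy ‖∇φ_{1/(λ+μ)}(z̄)‖ ≤ ((λ+μ)/λ)‖∇φ̂_{1/λ}(x̄)‖ + μD. -/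
open scoped BigOperators

/-- Adding a real constant commutes with taking infima in `EReal`, for finite infima. -/
theorem EReal.eq_add_of_coe_eq_iInf {ι : Sort*} {F : ι → EReal} {m n c : ℝ}
    (hm : (m : EReal) = ⨅ i, F i) (hn : (n : EReal) = ⨅ i, F i + (c : EReal)) :
    n = m + c := by
  apply le_antisymm
  · have h : ((n - c : ℝ) : EReal) ≤ m := by
      rw [hm]
      refine le_iInf fun i => ?_
      rw [EReal.coe_sub]
      refine EReal.sub_le_of_le_add ?_
      rw [hn]
      exact iInf_le _ i
    have := EReal.coe_le_coe_iff.1 h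
    linarith
  · rw [← EReal.coe_le_coe_iff, hn]
    refine le_iInf fun i => ?_
    rw [EReal.coe_add, hm]
    gcongr
    exact iInf_le _ i

/-- Completing the square for a weighted sum of two squared distances. -/
theorem weighted_sq_dist_add_eq {E : Type*} [NormedAddCommGroup E] [InnerProductSpace ℝ E]
    {a b : ℝ} (hab : a + b ≠ 0) (x w y : E) :
    a / 2 * ‖y - x‖ ^ 2 + b / 2 * ‖y - w‖ ^ 2 =
      (b + a) / 2 * ‖y - ((a / (a + b)) • x + (b / (a + b)) • w)‖ ^ 2
        + a * b / (2 * (a + b)) * ‖w - x‖ ^ 2 := by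
  have hy : y - ((a / (a + b)) • x + (b / (a + b)) • w) =
      (a / (a + b)) • (y - x) + (b / (a + b)) • (y - w) := by
    have h1 : a / (a + b) + b / (a + b) = 1 := by field_simp
    calc y - ((a / (a + b)) • x + (b / (a + b)) • w)
        = (a / (a + b) + b / (a + b)) • y
          - ((a / (a + b)) • x + (b / (a + b)) • w) := by rw [h1, one_smul]
      _ = _ := by module
  have hw : w - x = (y - x) - (y - w) := by abel
  rw [hy, hw, norm_add_sq_real, norm_sub_sq_real (y - x) (y - w), norm_smul, norm_smul,
    real_inner_smul_left, real_inner_smul_right, mul_pow, mul_pow, Real.norm_eq_abs,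
    Real.norm_eq_abs, sq_abs, sq_abs]
  field_simp
  ring

/-- **Envelope comparison after adding a quadratic (proof of the main theorem).**
Let `φ : ℝ^d → ℝ ∪ {+∞}` be proper, lower semicontinuous and convex, `x_c ∈ ℝ^d`,
`μ, lam, D > 0`, and `φ̂ x = φ x + (μ/2)‖x - x_c‖²`.  For any `x̄` with `‖x̄ - x_c‖ ≤ D`,
set `z̄ = (μ/(μ+lam)) • x_c + (lam/(μ+lam)) • x̄`.  If `mφ` is the Moreau envelope
`φ_{1/(lam+μ)}` with gradient `gz` at `z̄`, and `mφ̂` the envelope `φ̂_{1/lam}` with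
gradient `gx` at `x̄`, then
`‖∇φ_{1/(lam+μ)}(z̄)‖ ≤ ((lam+μ)/lam) ‖∇φ̂_{1/lam}(x̄)‖ + μ D`. -/
theorem envelope_comparison_quadratic_perturbation {d : ℕ}
    (φ : EuclideanSpace ℝ (Fin d) → EReal)
    (hne_bot : ∀ x, φ x ≠ ⊥) (hproper : ∃ x, φ x ≠ ⊤)
    (hlsc : LowerSemicontinuous φ) (hconv : ERealConvexOn φ)
    (xc : EuclideanSpace ℝ (Fin d))
    (μ lam D : ℝ) (hμ : 0 < μ) (hlam : 0 < lam) (hD : 0 < D)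
    (φhat : EuclideanSpace ℝ (Fin d) → EReal)
    (hφhat : ∀ x, φhat x = φ x + ((μ / 2 * ‖x - xc‖ ^ 2 : ℝ) : EReal))
    (xbar : EuclideanSpace ℝ (Fin d)) (hxbarD : ‖xbar - xc‖ ≤ D)
    (zbar : EuclideanSpace ℝ (Fin d))
    (hzbar : zbar = (μ / (μ + lam)) • xc + (lam / (μ + lam)) • xbar)
    (mφ : EuclideanSpace ℝ (Fin d) → ℝ)
    (hmφ : ∀ w, ((mφ w : ℝ) : EReal) =
        ⨅ y, φ y + (((lam + μ) / 2 * ‖y - w‖ ^ 2 : ℝ) : EReal))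
    (mφhat : EuclideanSpace ℝ (Fin d) → ℝ)
    (hmφhat : ∀ w, ((mφhat w : ℝ) : EReal) =
        ⨅ y, φhat y + ((lam / 2 * ‖y - w‖ ^ 2 : ℝ) : EReal))
    (gz : EuclideanSpace ℝ (Fin d)) (hgz : HasGradientAt mφ gz zbar)
    (gx : EuclideanSpace ℝ (Fin d)) (hgx : HasGradientAt mφhat gx xbar) :
    ‖gz‖ ≤ ((lam + μ) / lam) * ‖gx‖ + μ * D := by
  have hs : μ + lam ≠ 0 := by positivity
  have henv : ∀ w, mφhat w = mφ ((μ / (μ + lam)) • xc + (lam / (μ + lam)) • w)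
      + μ * lam / (2 * (μ + lam)) * ‖w - xc‖ ^ 2 := by
    intro w
    refine EReal.eq_add_of_coe_eq_iInf (hmφ _) ?_
    rw [hmφhat]
    refine iInf_congr fun y => ?_
    rw [hφhat, add_assoc, add_assoc, ← EReal.coe_add, ← EReal.coe_add,
      weighted_sq_dist_add_eq hs]
  have hlin : HasFDerivAt
      (fun w : EuclideanSpace ℝ (Fin d) => (μ / (μ + lam)) • xc + (lam / (μ + lam)) • w)
      ((lam / (μ + lam)) • ContinuousLinearMap.id ℝ _) xbar :=
    ((hasFDerivAt_id xbar).fun_const_smul _).const_add _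
  have hcomp := HasFDerivAt.comp xbar (hzbar ▸ hgz.hasFDerivAt) hlin
  have hsq := (((hasFDerivAt_id xbar).sub_const xc).norm_sq).const_mul
    (μ * lam / (2 * (μ + lam)))
  have hsum := hcomp.add hsq
  have hgx' := hgx.hasFDerivAt
  rw [funext henv] at hgx'
  have heq := hgx'.unique hsum
  have hgrad : gx = (lam / (μ + lam)) • gz + (μ * lam / (μ + lam)) • (xbar - xc) := by
    refine ext_inner_right ℝ fun v => ?_
    have hv := DFunLike.congr_fun heq v
    simp [inner_add_left, inner_sub_left, inner_smul_left] at hv ⊢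
    rw [hv]
    field_simp
  have hgz_eq : gz = ((lam + μ) / lam) • gx - μ • (xbar - xc) := by
    rw [hgrad, smul_add, smul_smul, smul_smul]
    have h1 : (lam + μ) / lam * (lam / (μ + lam)) = 1 := by field_simp; ring
    have h2 : (lam + μ) / lam * (μ * lam / (μ + lam)) = μ := by field_simp; ring
    rw [h1, h2, one_smul, add_sub_cancel_right]
  calc ‖gz‖ ≤ ‖((lam + μ) / lam) • gx‖ + ‖μ • (xbar - xc)‖ := by
        rw [hgz_eq]; exact norm_sub_le _ _
    _ = ((lam + μ) / lam) * ‖gx‖ + μ * ‖xbar - xc‖ := by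
        rw [norm_smul, norm_smul, Real.norm_of_nonneg (by positivity),
          Real.norm_of_nonneg hμ.le]
    _ ≤ ((lam + μ) / lam) * ‖gx‖ + μ * D := by gcongr
end
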